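/- Let T > 0, ε > 0 and 0 < ε₀ ≤ T. Let ω_ε, ω_{ε₀} : ℝ → [0,∞) be measurable, even, supported in [−ε, ε] and [−ε₀, ε₀] respectively, each with total integral 1. Let u, v : ℝ × [0,T] → ℝ be measurable with u(·,t), v(·,t) integrable on ℝ for each t ∈ [0,T]. Define the moduli μ(w, ε) = sup_{|z|≤ε} ∫_ℝ |w(x+z) − w(x)| dx for w : ℝ → ℝ, and ν_T(w, ε₀) = sup_{0≤σ≤ε₀} ∫_ℝ |w(x, T−σ) − w(x,T)| dx for w : ℝ × [0,T] → ℝ. Assume μ(u(·,T), ε), μ(v(·,T), ε), ν_T(u, ε₀) and ν_T(v, ε₀) are all finite. Then ∫_0^T ∫_ℝ ∫_ℝ (|u(x,T) − v(y,s)| + |v(x,T) − u(y,s)|)·ω_ε(x−y)·ω_{ε₀}(T−s) dx dy ds ≥ ‖u(·,T) − v(·,T)‖_{L¹(ℝ)} − (1/2)·(ν_T(u, ε₀) + μ(u(·,T), ε) + ν_T(v, ε₀) + μ(v(·,T), ε)). -/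

import Mathlib

open MeasureTheory

lemma lintegral_ofReal_eq_one {w : ℝ → ℝ} (hw : ∀ x, 0 ≤ w x) (h : ∫ x, w x = 1) :
    ∫⁻ x, ENNReal.ofReal (w x) = 1 := by
  have hi : Integrable w := Integrable.of_integral_ne_zero (by simp [h])
  rw [← ofReal_integral_eq_lintegral_ofReal hi (ae_of_all _ hw), h, ENNReal.ofReal_one]

/-- An even nonnegative kernel of mass one, supported in `[-T, T]`, has mass at least one half on
`[0, T]`. -/
lemma ofReal_half_le_setLIntegral_comp_sub {T : ℝ} {w : ℝ → ℝ}
    (hw : ∀ x, 0 ≤ w x) (heven : ∀ x, w (-x) = w x) (hsupp : ∀ x, T < |x| → w x = 0)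
    (hint : ∫ x, w x = 1) :
    ENNReal.ofReal (1 / 2) ≤ ∫⁻ s in Set.Icc 0 T, ENNReal.ofReal (w (T - s)) := by
  have hi : Integrable w := Integrable.of_integral_ne_zero (by simp [hint])
  have habs : (fun x => w |x|) = w := by
    funext x
    rcases abs_choice x with h | h <;> simp [h, heven]
  have hhalf : ∫ x in Set.Ioi 0, w x = 1 / 2 := by
    have := integral_comp_abs (f := w)
    rw [habs, hint] at this
    linarith
  rw [← hhalf, ofReal_integral_eq_lintegral_ofReal hi.integrableOn (ae_of_all _ hw),
    ← lintegral_indicator measurableSet_Ioi, ← lintegral_indicator measurableSet_Icc,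
    ← lintegral_sub_left_eq_self _ T]
  refine lintegral_mono fun s => ?_
  by_cases hs : s ∈ Set.Icc 0 T
  · rw [Set.indicator_of_mem hs]
    exact Set.indicator_le_self _ _ _
  · rw [Set.indicator_of_notMem hs]
    by_cases hpos : T - s ∈ Set.Ioi 0
    · rw [Set.indicator_of_mem hpos, hsupp (T - s), ENNReal.ofReal_zero]
      rw [Set.mem_Ioi] at hpos
      rw [Set.mem_Icc, not_and_or, not_le, not_le] at hs
      rw [abs_of_pos hpos]
      rcases hs with hs | hs <;> linarith
    · rw [Set.indicator_of_notMem hpos]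

lemma ofReal_integral_abs_sub {f g : ℝ → ℝ} (hf : Integrable f) (hg : Integrable g) :
    ENNReal.ofReal (∫ x, |f x - g x|) = ∫⁻ x, ENNReal.ofReal |f x - g x| :=
  ofReal_integral_eq_lintegral_ofReal (hf.sub hg).abs (ae_of_all _ fun _ => abs_nonneg _)

/-- Mollifying the translation defect of `g` costs at most its `L¹` modulus of continuity. -/
lemma lintegral_mollified_translation_le {ε m : ℝ} {w g : ℝ → ℝ} (hw_meas : Measurable w)
    (hw : ∀ x, 0 ≤ w x) (hsupp : ∀ x, ε < |x| → w x = 0) (hint : ∫ x, w x = 1)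
    (hg_meas : Measurable g) (hg : Integrable g)
    (hm : ∀ z, |z| ≤ ε → ∫ x, |g (x + z) - g x| ≤ m) :
    ∫⁻ y, ∫⁻ x, ENNReal.ofReal |g x - g y| * ENNReal.ofReal (w (x - y)) ≤ ENNReal.ofReal m := by
  calc ∫⁻ y, ∫⁻ x, ENNReal.ofReal |g x - g y| * ENNReal.ofReal (w (x - y))
      = ∫⁻ y, ∫⁻ z, ENNReal.ofReal |g (y + z) - g y| * ENNReal.ofReal (w z) := by
        refine lintegral_congr fun y => ?_
        rw [← lintegral_add_left_eq_self _ y]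
        simp
    _ = ∫⁻ z, ∫⁻ y, ENNReal.ofReal |g (y + z) - g y| * ENNReal.ofReal (w z) :=
        lintegral_lintegral_swap (by fun_prop)
    _ ≤ ∫⁻ z, ENNReal.ofReal m * ENNReal.ofReal (w z) := by
        refine lintegral_mono fun z => ?_
        rw [lintegral_mul_const _ (by fun_prop)]
        by_cases hz : |z| ≤ ε
        · gcongr
          rw [← ofReal_integral_abs_sub (hg.comp_add_right z) hg]
          exact ENNReal.ofReal_le_ofReal (hm z hz)
        · simp [hsupp z (not_le.mp hz)]
    _ = ENNReal.ofReal m := by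
        rw [lintegral_const_mul _ (by fun_prop), lintegral_ofReal_eq_one hw hint, mul_one]

/-- Lower bound for the mollified double integral of `|f x - h y|` by `‖f - g‖₁`, up to the `L¹`
modulus of continuity of `g` and the `L¹` distance from `h` to `g`. -/
lemma ofReal_integral_abs_sub_le_mollified {ε m n : ℝ} {w f g h : ℝ → ℝ}
    (hw_meas : Measurable w) (hw : ∀ x, 0 ≤ w x) (hsupp : ∀ x, ε < |x| → w x = 0)
    (hint : ∫ x, w x = 1) (hf_meas : Measurable f) (hg_meas : Measurable g)
    (hh_meas : Measurable h) (hf : Integrable f) (hg : Integrable g) (hh : Integrable h)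
    (hm : ∀ z, |z| ≤ ε → ∫ x, |g (x + z) - g x| ≤ m) (hn : ∫ x, |h x - g x| ≤ n) :
    ENNReal.ofReal (∫ x, |f x - g x|) ≤
      (∫⁻ y, ∫⁻ x, ENNReal.ofReal |f x - h y| * ENNReal.ofReal (w (x - y))) +
        ENNReal.ofReal m + ENNReal.ofReal n := by
  have hmass := lintegral_ofReal_eq_one hw hint
  calc ENNReal.ofReal (∫ x, |f x - g x|)
      = ∫⁻ x, ∫⁻ y, ENNReal.ofReal |f x - g x| * ENNReal.ofReal (w (x - y)) := by
        rw [ofReal_integral_abs_sub hf hg]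
        refine lintegral_congr fun x => ?_
        rw [lintegral_const_mul _ (by fun_prop),
          lintegral_sub_left_eq_self (fun z => ENNReal.ofReal (w z)) x, hmass, mul_one]
    _ = ∫⁻ y, ∫⁻ x, ENNReal.ofReal |f x - g x| * ENNReal.ofReal (w (x - y)) :=
        lintegral_lintegral_swap (by fun_prop)
    _ ≤ ∫⁻ y, ∫⁻ x, (ENNReal.ofReal |f x - h y| * ENNReal.ofReal (w (x - y)) +
          ENNReal.ofReal |g x - g y| * ENNReal.ofReal (w (x - y)) +
          ENNReal.ofReal |h y - g y| * ENNReal.ofReal (w (x - y))) := by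
        refine lintegral_mono fun y => lintegral_mono fun x => ?_
        rw [← add_mul, ← add_mul, ← ENNReal.ofReal_add (abs_nonneg _) (abs_nonneg _),
          ← ENNReal.ofReal_add (by positivity) (abs_nonneg _)]
        gcongr
        have h₁ := abs_sub_le (f x) (h y) (g x)
        have h₂ := abs_sub_le (h y) (g y) (g x)
        rw [abs_sub_comm (g y) (g x)] at h₂
        linarith
    _ = (∫⁻ y, ∫⁻ x, ENNReal.ofReal |f x - h y| * ENNReal.ofReal (w (x - y))) +
          (∫⁻ y, ∫⁻ x, ENNReal.ofReal |g x - g y| * ENNReal.ofReal (w (x - y))) +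
          ∫⁻ y, ENNReal.ofReal |h y - g y| := by
        rw [← lintegral_add_left (by fun_prop), ← lintegral_add_left (by fun_prop)]
        refine lintegral_congr fun y => ?_
        rw [lintegral_add_left (by fun_prop), lintegral_add_left (by fun_prop),
          lintegral_const_mul _ (by fun_prop),
          lintegral_sub_right_eq_self (fun z => ENNReal.ofReal (w z)) y, hmass, mul_one]
    _ ≤ _ := by
        gcongr
        · exact lintegral_mollified_translation_le hw_meas hw hsupp hint hg_meas hg hm
        · rw [← ofReal_integral_abs_sub hh hg]
          exact ENNReal.ofReal_le_ofReal hn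

/-- lower estimate for the terminal-time term in the Kuznetsov
doubling-of-variables argument on the whole line.  Here `μu, μv` are (finite)
upper bounds for the spatial moduli of continuity `μ(u(·,T), ε)`,
`μ(v(·,T), ε)` and `νu, νv` are (finite) upper bounds for the temporal moduli
`ν_T(u, ε₀)`, `ν_T(v, ε₀)`. -/
theorem kuznetsov_terminal_term_estimate
    (T ε ε₀ : ℝ) (hT : 0 < T) (hε : 0 < ε) (hε₀ : 0 < ε₀) (hε₀T : ε₀ ≤ T)
    (ωε ωε₀ : ℝ → ℝ)
    (hωε_meas : Measurable ωε) (hωε₀_meas : Measurable ωε₀)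
    (hωε_nonneg : ∀ x, 0 ≤ ωε x) (hωε₀_nonneg : ∀ x, 0 ≤ ωε₀ x)
    (hωε_even : ∀ x, ωε (-x) = ωε x) (hωε₀_even : ∀ x, ωε₀ (-x) = ωε₀ x)
    (hωε_supp : ∀ x : ℝ, ε < |x| → ωε x = 0)
    (hωε₀_supp : ∀ x : ℝ, ε₀ < |x| → ωε₀ x = 0)
    (hωε_int : ∫ x, ωε x = 1) (hωε₀_int : ∫ x, ωε₀ x = 1)
    (u v : ℝ → ℝ → ℝ)
    (hu_meas : Measurable (Function.uncurry u))
    (hv_meas : Measurable (Function.uncurry v))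
    (hu_int : ∀ t ∈ Set.Icc (0 : ℝ) T, Integrable (fun x => u x t))
    (hv_int : ∀ t ∈ Set.Icc (0 : ℝ) T, Integrable (fun x => v x t))
    (μu μv νu νv : ℝ)
    (hμu : ∀ z : ℝ, |z| ≤ ε → ∫ x, |u (x + z) T - u x T| ≤ μu)
    (hμv : ∀ z : ℝ, |z| ≤ ε → ∫ x, |v (x + z) T - v x T| ≤ μv)
    (hνu : ∀ σ : ℝ, 0 ≤ σ → σ ≤ ε₀ → ∫ x, |u x (T - σ) - u x T| ≤ νu)
    (hνv : ∀ σ : ℝ, 0 ≤ σ → σ ≤ ε₀ → ∫ x, |v x (T - σ) - v x T| ≤ νv) :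
    ENNReal.ofReal
        ((∫ x, |u x T - v x T|) - (1 / 2) * (νu + μu + νv + μv)) ≤
      ∫⁻ s in Set.Icc (0 : ℝ) T, ∫⁻ y, ∫⁻ x,
        ENNReal.ofReal
          ((|u x T - v y s| + |v x T - u y s|) * ωε (x - y) * ωε₀ (T - s)) := by
  have hT_mem : T ∈ Set.Icc 0 T := ⟨hT.le, le_rfl⟩
  have hu_slice : ∀ t, Measurable fun x => u x t := fun t => hu_meas.of_uncurry_right
  have hv_slice : ∀ t, Measurable fun x => v x t := fun t => hv_meas.of_uncurry_right
  set N : ℝ := ∫ x, |u x T - v x T| with hN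
  set S : ℝ := νu + μu + νv + μv with hS
  have hN_nonneg : 0 ≤ N := integral_nonneg fun _ => abs_nonneg _
  have hμu_nonneg : 0 ≤ μu :=
    (integral_nonneg fun _ => abs_nonneg _).trans (hμu 0 (by simpa using hε.le))
  have hμv_nonneg : 0 ≤ μv :=
    (integral_nonneg fun _ => abs_nonneg _).trans (hμv 0 (by simpa using hε.le))
  have hνu_nonneg : 0 ≤ νu :=
    (integral_nonneg fun _ => abs_nonneg _).trans (hνu 0 le_rfl hε₀.le)
  have hνv_nonneg : 0 ≤ νv :=
    (integral_nonneg fun _ => abs_nonneg _).trans (hνv 0 le_rfl hε₀.le)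
  calc ENNReal.ofReal (N - 1 / 2 * S)
      = ENNReal.ofReal (2 * N - S) * ENNReal.ofReal (1 / 2) := by
        rw [← ENNReal.ofReal_mul' (by norm_num)]
        congr 1
        ring
    _ ≤ ENNReal.ofReal (2 * N - S) *
          ∫⁻ s in Set.Icc 0 T, ENNReal.ofReal (ωε₀ (T - s)) := by
        gcongr
        exact ofReal_half_le_setLIntegral_comp_sub hωε₀_nonneg hωε₀_even
          (fun x hx => hωε₀_supp x (hε₀T.trans_lt hx)) hωε₀_int
    _ = ∫⁻ s in Set.Icc 0 T, ENNReal.ofReal (2 * N - S) * ENNReal.ofReal (ωε₀ (T - s)) :=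
        (lintegral_const_mul _ (by fun_prop)).symm
    _ ≤ _ := ?_
  refine setLIntegral_mono' measurableSet_Icc fun s hs => ?_
  by_cases hTs : ε₀ < |T - s|
  · simp [hωε₀_supp _ hTs]
  have hσ : 0 ≤ T - s := sub_nonneg.mpr hs.2
  rw [abs_of_nonneg hσ, not_lt] at hTs
  have hνu_s := hνu (T - s) hσ hTs
  have hνv_s := hνv (T - s) hσ hTs
  rw [sub_sub_cancel] at hνu_s hνv_s
  have h₁ := ofReal_integral_abs_sub_le_mollified hωε_meas hωε_nonneg hωε_supp hωε_int
    (hu_slice T) (hv_slice T) (hv_slice s) (hu_int T hT_mem) (hv_int T hT_mem) (hv_int s hs)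
    hμv hνv_s
  have h₂ := ofReal_integral_abs_sub_le_mollified hωε_meas hωε_nonneg hωε_supp hωε_int
    (hv_slice T) (hu_slice T) (hu_slice s) (hv_int T hT_mem) (hu_int T hT_mem) (hu_int s hs)
    hμu hνu_s
  simp_rw [abs_sub_comm (v _ T) (u _ T)] at h₂
  have hu_T := hu_slice T
  have hv_T := hv_slice T
  have hu_s := hu_slice s
  have hv_s := hv_slice s
  calc ENNReal.ofReal (2 * N - S) * ENNReal.ofReal (ωε₀ (T - s))
      ≤ ((∫⁻ y, ∫⁻ x, ENNReal.ofReal |u x T - v y s| * ENNReal.ofReal (ωε (x - y))) +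
          ∫⁻ y, ∫⁻ x, ENNReal.ofReal |v x T - u y s| * ENNReal.ofReal (ωε (x - y))) *
            ENNReal.ofReal (ωε₀ (T - s)) := by
        gcongr
        rw [ENNReal.ofReal_sub _ (by positivity), tsub_le_iff_right, two_mul,
          ENNReal.ofReal_add hN_nonneg hN_nonneg, hS,
          ENNReal.ofReal_add (by positivity) hμv_nonneg,
          ENNReal.ofReal_add (by positivity) hνv_nonneg,
          ENNReal.ofReal_add hνu_nonneg hμu_nonneg]
        refine (add_le_add h₁ h₂).trans (le_of_eq ?_)
        ring
    _ = _ := by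
        rw [← lintegral_add_left (by fun_prop), ← lintegral_mul_const _ (by fun_prop)]
        refine lintegral_congr fun y => ?_
        rw [← lintegral_add_left (by fun_prop), ← lintegral_mul_const _ (by fun_prop)]
        refine lintegral_congr fun x => ?_
        rw [ENNReal.ofReal_mul' (hωε₀_nonneg _), ENNReal.ofReal_mul' (hωε_nonneg _),
          ENNReal.ofReal_add (abs_nonneg _) (abs_nonneg _), ← add_mul]
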